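/- arXiv:2411.16913 — 5 statements merged into one kernel-verified Lean document; each statement's English description precedes it below -/
import Mathlib

section
/- Let p : ℕ → ℝ be a non-degenerate discrete probability distribution and μ(p) = ⨆ i, p i. Then: (a) if (fun i => p i * Real.log (p i)) is summable, the Shannon entropy satisfies H_SH(p) ≥ -log μ(p) > 0; (b) for every α > 0 with α ≠ 1 such that (fun i => (p i)^α) is summable, the Rényi entropy satisfies H_R(α,p) ≥ -log μ(p); (c) for every α > 0 such that (fun i => (p i)^α) and (fun i => (p i)^α * Real.log (p i)) are summable, the one-parameter generalized Rényi entropy satisfies H_GR(α,p) ≥ -log μ(p); (d) for all α, β > 0 with α ≠ β such that (fun i => (p i)^α) and (fun i => (p i)^β) are summable, the two-parameter generalized Rényi entropy satisfies H_GR(α,β,p) ≥ -log μ(p). -/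
open Real Filter Topology

/-- A power sum of larger exponent is bounded by a power of an upper bound of the terms times the
power sum of smaller exponent. -/
theorem tsum_rpow_le_rpow_mul_tsum_rpow {ι : Type*} {p : ι → ℝ} {M : ℝ} (hp : ∀ i, 0 < p i)
    (hM : ∀ i, p i ≤ M) {α β : ℝ} (hαβ : α ≤ β) (hα : Summable fun i => p i ^ α)
    (hβ : Summable fun i => p i ^ β) :
    ∑' i, p i ^ β ≤ M ^ (β - α) * ∑' i, p i ^ α := by
  rw [← tsum_mul_left]
  refine hβ.tsum_le_tsum (fun i => ?_) (hα.mul_left _)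
  calc p i ^ β = p i ^ (β - α) * p i ^ α := by rw [← Real.rpow_add (hp i), sub_add_cancel]
    _ ≤ M ^ (β - α) * p i ^ α := mul_le_mul_of_nonneg_right
        (Real.rpow_le_rpow (hp i).le (hM i) (sub_nonneg.2 hαβ)) (Real.rpow_nonneg (hp i).le _)

theorem tsum_rpow_pos {ι : Type*} [Nonempty ι] {p : ι → ℝ} (hp : ∀ i, 0 < p i) {α : ℝ}
    (hα : Summable fun i => p i ^ α) : 0 < ∑' i, p i ^ α :=
  hα.tsum_pos (fun i => (Real.rpow_pos_of_pos (hp i) α).le) (Classical.arbitrary ι)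
    (Real.rpow_pos_of_pos (hp _) α)

theorem neg_log_le_inv_mul_log_tsum_rpow_div {ι : Type*} [Nonempty ι] {p : ι → ℝ} {M : ℝ}
    (hp : ∀ i, 0 < p i) (hM : ∀ i, p i ≤ M) {α β : ℝ} (hαβ : α ≠ β)
    (hα : Summable fun i => p i ^ α) (hβ : Summable fun i => p i ^ β) :
    -Real.log M ≤ (β - α)⁻¹ * Real.log ((∑' i, p i ^ α) / (∑' i, p i ^ β)) := by
  wlog h : α < β generalizing α β
  · have := this hαβ.symm hβ hα (lt_of_le_of_ne (not_lt.1 h) hαβ.symm)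
    rwa [← inv_div, Real.log_inv, ← neg_sub, inv_neg, neg_mul_neg] at this
  have hM0 : 0 < M := (hp (Classical.arbitrary ι)).trans_le (hM _)
  have hA := tsum_rpow_pos hp hα
  have hB := tsum_rpow_pos hp hβ
  have hlog := Real.log_le_log hB (tsum_rpow_le_rpow_mul_tsum_rpow hp hM h.le hα hβ)
  rw [Real.log_mul (Real.rpow_pos_of_pos hM0 _).ne' hA.ne', Real.log_rpow hM0] at hlog
  rw [Real.log_div hA.ne' hB.ne', le_inv_mul_iff₀ (sub_pos.2 h)]
  linarith

theorem neg_log_le_neg_tsum_rpow_mul_log_div {ι : Type*} [Nonempty ι] {p : ι → ℝ} {M : ℝ}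
    (hp : ∀ i, 0 < p i) (hM : ∀ i, p i ≤ M) {α : ℝ} (hα : Summable fun i => p i ^ α)
    (hlog : Summable fun i => p i ^ α * Real.log (p i)) :
    -Real.log M ≤ -(∑' i, p i ^ α * Real.log (p i)) / (∑' i, p i ^ α) := by
  rw [le_div_iff₀ (tsum_rpow_pos hp hα), neg_mul, neg_le_neg_iff, mul_comm, ← tsum_mul_right]
  exact hlog.tsum_le_tsum (fun i => mul_le_mul_of_nonneg_left (Real.log_le_log (hp i) (hM i))
    (Real.rpow_nonneg (hp i).le _)) (hα.mul_right _)

theorem add_le_of_hasSum {ι : Type*} {p : ι → ℝ} {s : ℝ} (hp : ∀ i, 0 ≤ p i) (hs : HasSum p s)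
    {i j : ι} (hij : i ≠ j) : p i + p j ≤ s := by
  classical
  rw [← Finset.sum_pair hij]
  exact sum_le_hasSum _ (fun k _ => hp k) hs

theorem iSup_lt_one_of_hasSum_one {p : ℕ → ℝ} (hp : ∀ i, 0 < p i) (hs : HasSum p 1) :
    ⨆ i, p i < 1 := by
  have hle : ⨆ i, p i ≤ 1 - min (p 0) (p 1) := by
    refine ciSup_le fun i => ?_
    rcases eq_or_ne i 0 with rfl | hi
    · linarith [add_le_of_hasSum (fun k => (hp k).le) hs zero_ne_one, min_le_right (p 0) (p 1)]
    · linarith [add_le_of_hasSum (fun k => (hp k).le) hs hi, min_le_left (p 0) (p 1)]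
  linarith [lt_min (hp 0) (hp 1)]

/-- positivity/lower bounds for Shannon, Rényi, and the two generalized
Rényi entropies of a non-degenerate discrete probability distribution. -/
theorem entropy_lower_bounds
    (p : ℕ → ℝ) (hp : ∀ i, 0 < p i ∧ p i < 1) (hsum : HasSum p 1) :
    (Summable (fun i => p i * Real.log (p i)) →
      (-∑' i, p i * Real.log (p i)) ≥ -Real.log (⨆ i, p i) ∧
        0 < -Real.log (⨆ i, p i)) ∧
    (∀ α : ℝ, 0 < α → α ≠ 1 → Summable (fun i => (p i) ^ α) →
      (1 - α)⁻¹ * Real.log (∑' i, (p i) ^ α) ≥ -Real.log (⨆ i, p i)) ∧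
    (∀ α : ℝ, 0 < α → Summable (fun i => (p i) ^ α) →
      Summable (fun i => (p i) ^ α * Real.log (p i)) →
      -(∑' i, (p i) ^ α * Real.log (p i)) / (∑' i, (p i) ^ α) ≥
        -Real.log (⨆ i, p i)) ∧
    (∀ α β : ℝ, 0 < α → 0 < β → α ≠ β →
      Summable (fun i => (p i) ^ α) → Summable (fun i => (p i) ^ β) →
      (β - α)⁻¹ * Real.log ((∑' i, (p i) ^ α) / (∑' i, (p i) ^ β)) ≥
        -Real.log (⨆ i, p i)) := by
  have hpos : ∀ i, 0 < p i := fun i => (hp i).1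
  have hM : ∀ i, p i ≤ ⨆ i, p i :=
    le_ciSup ⟨1, Set.forall_mem_range.2 fun i => (hp i).2.le⟩
  have hone : Summable fun i => p i ^ (1 : ℝ) := by simpa using hsum.summable
  refine ⟨fun h => ⟨?_, ?_⟩, fun α _ hα1 hα => ?_,
    fun α _ hα hlog => neg_log_le_neg_tsum_rpow_mul_log_div hpos hM hα hlog,
    fun α β _ _ hαβ hα hβ => neg_log_le_inv_mul_log_tsum_rpow_div hpos hM hαβ hα hβ⟩
  · simpa [hsum.tsum_eq] using
      neg_log_le_neg_tsum_rpow_mul_log_div hpos hM hone (by simpa using h)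
  · exact neg_pos.2 (Real.log_neg ((hpos 0).trans_le (hM 0))
      (iSup_lt_one_of_hasSum_one hpos hsum))
  · simpa [hsum.tsum_eq] using neg_log_le_inv_mul_log_tsum_rpow_div hpos hM hα1 hα hone
end

section
/- Let p : ℕ → ℝ be a non-degenerate discrete probability distribution, μ(p) = ⨆ i, p i, and let α > 0 with α ≠ 1 be such that (fun i => (p i)^α) is summable. Then the Tsallis entropy satisfies H_T(α,p) ≥ (μ(p)^{α-1} - 1)/(1-α) > 0. -/
open Real Filter Topology

/-- The supremum of a non-degenerate discrete probability distribution is less than one. -/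
theorem iSup_lt_one_of_hasSum {p : ℕ → ℝ} (hp : ∀ i, 0 < p i ∧ p i < 1) (hsum : HasSum p 1) :
    ⨆ i, p i < 1 := by
  have hle : ∀ i, p i ≤ max (p 0) (1 - p 0) := by
    intro i
    rcases eq_or_ne i 0 with rfl | hi
    · exact le_max_left _ _
    · refine le_max_of_le_right ?_
      have h := sum_le_hasSum {i, 0} (fun j _ => (hp j).1.le) hsum
      rw [Finset.sum_pair hi] at h
      linarith
  refine (ciSup_le hle).trans_lt (max_lt (hp 0).2 ?_)
  linarith [(hp 0).1]

/-- lower bound and positivity for the Tsallis entropy of a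
non-degenerate discrete probability distribution. -/
theorem tsallis_entropy_lower_bound
    (p : ℕ → ℝ) (hp : ∀ i, 0 < p i ∧ p i < 1) (hsum : HasSum p 1)
    (α : ℝ) (hα : 0 < α) (hα1 : α ≠ 1)
    (hsummable : Summable (fun i => (p i) ^ α)) :
    (1 - α)⁻¹ * ((∑' i, (p i) ^ α) - 1) ≥
      ((⨆ i, p i) ^ (α - 1) - 1) / (1 - α) ∧
    0 < ((⨆ i, p i) ^ (α - 1) - 1) / (1 - α) := by
  have hbdd : BddAbove (Set.range p) := ⟨1, by rintro _ ⟨i, rfl⟩; exact (hp i).2.le⟩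
  have hle : ∀ i, p i ≤ ⨆ i, p i := le_ciSup hbdd
  have hlt := iSup_lt_one_of_hasSum hp hsum
  have hpos : 0 < ⨆ i, p i := (hp 0).1.trans_le (hle 0)
  generalize (⨆ i, p i) = μ at hle hlt hpos ⊢
  have hmul : HasSum (fun i => p i * μ ^ (α - 1)) (μ ^ (α - 1)) := by
    simpa using hsum.mul_right (μ ^ (α - 1))
  have hrpow : ∀ i, p i ^ α = p i * p i ^ (α - 1) := fun i => by
    rw [rpow_sub_one (hp i).1.ne', mul_div_cancel₀ _ (hp i).1.ne']
  rw [ge_iff_le, div_eq_inv_mul]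
  rcases lt_or_gt_of_ne hα1 with h | h
  · have hinv : 0 < (1 - α)⁻¹ := inv_pos.2 (by linarith)
    refine ⟨mul_le_mul_of_nonneg_left (sub_le_sub_right ?_ 1) hinv.le, mul_pos hinv ?_⟩
    · refine hasSum_le (fun i => ?_) hmul hsummable.hasSum
      rw [hrpow]
      exact mul_le_mul_of_nonneg_left
        (rpow_le_rpow_of_nonpos (hp i).1 (hle i) (by linarith)) (hp i).1.le
    · exact sub_pos.2 (one_lt_rpow_of_pos_of_lt_one_of_neg hpos hlt (by linarith))
  · have hinv : (1 - α)⁻¹ < 0 := inv_lt_zero.2 (by linarith)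
    refine ⟨mul_le_mul_of_nonpos_left (sub_le_sub_right ?_ 1) hinv.le,
      mul_pos_of_neg_of_neg hinv ?_⟩
    · refine hasSum_le (fun i => ?_) hsummable.hasSum hmul
      rw [hrpow]
      exact mul_le_mul_of_nonneg_left
        (rpow_le_rpow (hp i).1.le (hle i) (by linarith)) (hp i).1.le
    · exact sub_neg.2 (rpow_lt_one hpos.le hlt (by linarith))
end

section
/- For the Poisson probabilities: (i) for every α with 0 < α < 1, the function λ ↦ ψ(α,λ) is strictly increasing on (0,∞), and ψ(α,λ) ≥ (2π·⌊λ⌋)^{(1-α)/2} for all λ ≥ 1; (ii) for every α > 1, the function λ ↦ ψ(α,λ) is strictly decreasing on (0,∞), and ψ(α,λ) ≤ (2π·⌊λ⌋)^{-(α-1)/2} for all λ ≥ 1. Here ⌊λ⌋ denotes the integer part of λ. -/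
open Real Filter Topology

/-- The Poisson probabilities `p_i(λ) = e^{-λ} λ^i / i!`. -/
noncomputable def poissonP (l : ℝ) (i : ℕ) : ℝ :=
  Real.exp (-l) * l ^ i / (Nat.factorial i)

/-- `ψ(α,λ) = ∑_{i=0}^∞ (p_i(λ))^α`. -/
noncomputable def psiPoisson (α l : ℝ) : ℝ :=
  ∑' i, (poissonP l i) ^ α

open Finset in
/-- Weighted Jensen inequality for `x ↦ x ^ α`, `1 ≤ α`, with weights of total mass at most `1`. -/
theorem rpow_sum_mul_le_of_sum_le_one {ι : Type*} (s : Finset ι) {w x : ι → ℝ} {α : ℝ}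
    (hα : 1 ≤ α) (hw : ∀ i ∈ s, 0 ≤ w i) (hx : ∀ i ∈ s, 0 ≤ x i)
    (hpos : 0 < ∑ i ∈ s, w i) (hle : ∑ i ∈ s, w i ≤ 1) :
    (∑ i ∈ s, w i * x i) ^ α ≤ ∑ i ∈ s, w i * x i ^ α := by
  set S := ∑ i ∈ s, w i
  have hJ := (convexOn_rpow hα).map_sum_le (t := s) (w := fun i => w i / S) (p := x)
    (fun i hi => div_nonneg (hw i hi) hpos.le)
    (by rw [← sum_div, div_self hpos.ne']) hx
  simp only [smul_eq_mul, div_mul_eq_mul_div, ← sum_div] at hJ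
  have hN : 0 ≤ ∑ i ∈ s, w i * x i := sum_nonneg fun i hi => mul_nonneg (hw i hi) (hx i hi)
  have hR : 0 ≤ ∑ i ∈ s, w i * x i ^ α :=
    sum_nonneg fun i hi => mul_nonneg (hw i hi) (rpow_nonneg (hx i hi) _)
  rw [div_rpow hN hpos.le, div_le_div_iff₀ (by positivity) hpos] at hJ
  refine le_of_mul_le_mul_right (hJ.trans ?_) hpos
  have : S ^ α ≤ S ^ (1 : ℝ) := rpow_le_rpow_of_exponent_ge hpos hle hα
  rw [rpow_one] at this
  gcongr

open Finset in
/-- Weighted Jensen inequality for `x ↦ x ^ α`, `0 ≤ α ≤ 1`, with weights of total mass at most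
`1`. -/
theorem sum_mul_rpow_le_of_sum_le_one {ι : Type*} (s : Finset ι) {w x : ι → ℝ} {α : ℝ}
    (h0 : 0 ≤ α) (h1 : α ≤ 1) (hw : ∀ i ∈ s, 0 ≤ w i) (hx : ∀ i ∈ s, 0 ≤ x i)
    (hpos : 0 < ∑ i ∈ s, w i) (hle : ∑ i ∈ s, w i ≤ 1) :
    ∑ i ∈ s, w i * x i ^ α ≤ (∑ i ∈ s, w i * x i) ^ α := by
  set S := ∑ i ∈ s, w i
  have hJ := (concaveOn_rpow h0 h1).le_map_sum (t := s) (w := fun i => w i / S) (p := x)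
    (fun i hi => div_nonneg (hw i hi) hpos.le)
    (by rw [← sum_div, div_self hpos.ne']) hx
  simp only [smul_eq_mul, div_mul_eq_mul_div, ← sum_div] at hJ
  have hN : 0 ≤ ∑ i ∈ s, w i * x i := sum_nonneg fun i hi => mul_nonneg (hw i hi) (hx i hi)
  rw [div_rpow hN hpos.le, div_le_div_iff₀ hpos (by positivity)] at hJ
  have hR : 0 ≤ ∑ i ∈ s, w i * x i ^ α :=
    sum_nonneg fun i hi => mul_nonneg (hw i hi) (rpow_nonneg (hx i hi) _)
  refine le_of_mul_le_mul_right (le_trans ?_ hJ) hpos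
  have : S ^ (1 : ℝ) ≤ S ^ α := rpow_le_rpow_of_exponent_ge hpos hle h1
  rw [rpow_one] at this
  gcongr

theorem poissonP_pos {l : ℝ} (hl : 0 < l) (i : ℕ) : 0 < poissonP l i := by
  unfold poissonP; positivity

theorem hasSum_poissonP {l : ℝ} (hl : 0 ≤ l) : HasSum (poissonP l) 1 :=
  ProbabilityTheory.hasSum_one_poissonMeasure ⟨l, hl⟩

theorem poissonP_succ (l : ℝ) (i : ℕ) :
    poissonP l (i + 1) = poissonP l i * (l / (i + 1)) := by
  unfold poissonP
  rw [Nat.factorial_succ]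
  push_cast
  field_simp
  ring

theorem summable_poissonP_rpow {α l : ℝ} (hα : 0 < α) (hl : 0 < l) :
    Summable fun i => poissonP l i ^ α := by
  refine summable_of_ratio_test_tendsto_lt_one zero_lt_one
    (.of_forall fun i => (rpow_pos_of_pos (poissonP_pos hl i) α).ne') ?_
  have hlim : Tendsto (fun i : ℕ => (l / ((i : ℝ) + 1)) ^ α) atTop (𝓝 0) := by
    have h : Tendsto (fun i : ℕ => l / ((i : ℝ) + 1)) atTop (𝓝 0) :=
      tendsto_const_nhds.div_atTop
        (tendsto_atTop_add_const_right _ _ tendsto_natCast_atTop_atTop)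
    simpa [zero_rpow hα.ne'] using h.rpow_const (p := α) (Or.inr hα.le)
  refine hlim.congr fun i => ?_
  have hp := poissonP_pos hl i
  rw [norm_of_nonneg (rpow_nonneg (poissonP_pos hl _).le _),
    norm_of_nonneg (rpow_nonneg hp.le _), poissonP_succ,
    mul_rpow hp.le (by positivity), mul_div_cancel_left₀ _ (rpow_pos_of_pos hp α).ne']

/-- The convolution identity of the Poisson family. -/
theorem poissonP_add (h l : ℝ) (n : ℕ) :
    poissonP (h + l) n =
      ∑ kl ∈ Finset.HasAntidiagonal.antidiagonal n, poissonP h kl.1 * poissonP l kl.2 := by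
  unfold poissonP
  rw [(Commute.all h l).add_pow', neg_add, exp_add, Finset.mul_sum, Finset.sum_div]
  refine Finset.sum_congr rfl fun kl hkl => ?_
  obtain rfl := Finset.HasAntidiagonal.mem_antidiagonal.1 hkl
  have hc : ((kl.1 + kl.2).choose kl.1 : ℝ) * kl.1.factorial * kl.2.factorial
      = (kl.1 + kl.2).factorial := by
    rw [Nat.choose_symm_add]
    exact_mod_cast Nat.add_choose_mul_factorial_mul_factorial kl.1 kl.2
  rw [nsmul_eq_mul, ← hc]
  have := Nat.choose_pos (Nat.le_add_right kl.1 kl.2)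
  field_simp

theorem sum_antidiagonal_poissonP_le_one {h : ℝ} (hh : 0 < h) (n : ℕ) :
    ∑ kl ∈ Finset.HasAntidiagonal.antidiagonal n, poissonP h kl.1 ≤ 1 := by
  rw [Finset.Nat.sum_antidiagonal_eq_sum_range_succ_mk]
  exact sum_le_hasSum _ (fun i _ => (poissonP_pos hh i).le) (hasSum_poissonP hh.le)

theorem sum_antidiagonal_poissonP_pos {h : ℝ} (hh : 0 < h) (n : ℕ) :
    0 < ∑ kl ∈ Finset.HasAntidiagonal.antidiagonal n, poissonP h kl.1 :=
  Finset.sum_pos (fun kl _ => poissonP_pos hh kl.1)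
    ⟨(0, n), Finset.HasAntidiagonal.mem_antidiagonal.2 (zero_add n)⟩

/-- Convolving with a Poisson law does not change the total mass of `i ↦ p_i(l) ^ α`. -/
theorem hasSum_antidiagonal_poissonP_mul_rpow {α h l : ℝ} (hα : 0 < α) (hh : 0 < h)
    (hl : 0 < l) :
    HasSum (fun n => ∑ kl ∈ Finset.HasAntidiagonal.antidiagonal n,
        poissonP h kl.1 * poissonP l kl.2 ^ α)
      (psiPoisson α l) := by
  have hf := (hasSum_poissonP hh.le).summable.norm
  have hg := (summable_poissonP_rpow hα hl).norm
  have hs := (summable_norm_sum_mul_antidiagonal_of_summable_norm hf hg).of_norm.hasSum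
  rwa [← tsum_mul_tsum_eq_tsum_sum_antidiagonal_of_summable_norm hf hg,
    (hasSum_poissonP hh.le).tsum_eq, one_mul] at hs

theorem poissonP_add_zero_rpow (α h l : ℝ) :
    poissonP (h + l) 0 ^ α = exp (-(h * α)) * poissonP l 0 ^ α := by
  simp only [poissonP, pow_zero, mul_one, Nat.factorial_zero, Nat.cast_one, div_one,
    ← exp_mul, ← exp_add]
  ring_nf

theorem psiPoisson_strictAntiOn {α : ℝ} (hα : 1 < α) :
    StrictAntiOn (fun l => psiPoisson α l) (Set.Ioi (0 : ℝ)) := by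
  intro l hl m _ hlm
  obtain ⟨h, hh, rfl⟩ : ∃ h, 0 < h ∧ m = h + l := ⟨m - l, by linarith, by ring⟩
  rw [Set.mem_Ioi] at hl
  have hα0 : 0 < α := by linarith
  refine hasSum_lt (i := 0) (fun n => ?_) ?_
    (summable_poissonP_rpow hα0 (by linarith)).hasSum
    (hasSum_antidiagonal_poissonP_mul_rpow hα0 hh hl)
  · rw [poissonP_add]
    exact rpow_sum_mul_le_of_sum_le_one _ hα.le (fun kl _ => (poissonP_pos hh _).le)
      (fun kl _ => (poissonP_pos hl _).le) (sum_antidiagonal_poissonP_pos hh n)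
      (sum_antidiagonal_poissonP_le_one hh n)
  · rw [poissonP_add_zero_rpow]
    have hp := rpow_pos_of_pos (poissonP_pos hl 0) α
    have he : exp (-(h * α)) < exp (-h) := exp_lt_exp.2 (by nlinarith)
    simpa [poissonP] using mul_lt_mul_of_pos_right he hp

theorem psiPoisson_strictMonoOn {α : ℝ} (h0 : 0 < α) (h1 : α < 1) :
    StrictMonoOn (fun l => psiPoisson α l) (Set.Ioi (0 : ℝ)) := by
  intro l hl m _ hlm
  obtain ⟨h, hh, rfl⟩ : ∃ h, 0 < h ∧ m = h + l := ⟨m - l, by linarith, by ring⟩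
  rw [Set.mem_Ioi] at hl
  refine hasSum_lt (i := 0) (fun n => ?_) ?_
    (hasSum_antidiagonal_poissonP_mul_rpow h0 hh hl)
    (summable_poissonP_rpow h0 (by linarith)).hasSum
  · rw [poissonP_add]
    exact sum_mul_rpow_le_of_sum_le_one _ h0.le h1.le (fun kl _ => (poissonP_pos hh _).le)
      (fun kl _ => (poissonP_pos hl _).le) (sum_antidiagonal_poissonP_pos hh n)
      (sum_antidiagonal_poissonP_le_one hh n)
  · rw [poissonP_add_zero_rpow]
    have hp := rpow_pos_of_pos (poissonP_pos hl 0) α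
    have he : exp (-h) < exp (-(h * α)) := exp_lt_exp.2 (by nlinarith)
    simpa [poissonP] using mul_lt_mul_of_pos_right he hp

theorem poissonP_le_stirling {l : ℝ} (hl : 0 ≤ l) {i : ℕ} (hi : 1 ≤ i) :
    poissonP l i ≤ (2 * π * i) ^ (-(1 / 2) : ℝ) := by
  have hi0 : (0 : ℝ) < i := by exact_mod_cast hi
  have hexp : exp (-l) * l ^ i ≤ (i / exp 1) ^ i := by
    have h : (l / i) ^ i ≤ exp (l / i - 1) ^ i := by
      gcongr
      linarith [add_one_le_exp (l / i - 1)]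
    rw [← exp_nat_mul, mul_sub, mul_div_cancel₀ _ hi0.ne', mul_one, exp_sub, div_pow,
      div_le_div_iff₀ (by positivity) (by positivity)] at h
    rw [exp_neg, div_pow, ← exp_nat_mul, mul_one, le_div_iff₀ (by positivity)]
    rw [inv_mul_eq_div, div_mul_eq_mul_div, div_le_iff₀ (by positivity)]
    linarith
  rw [rpow_neg (by positivity), ← sqrt_eq_rpow, poissonP, div_le_iff₀ (by positivity),
    inv_mul_eq_div, le_div_iff₀ (by positivity)]
  calc exp (-l) * l ^ i * √(2 * π * i) ≤ (i / exp 1) ^ i * √(2 * π * i) := by gcongr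
    _ ≤ i.factorial := by rw [mul_comm]; exact Stirling.le_factorial_stirling i

theorem poissonP_le_of_le_floor {l : ℝ} (hl : 0 < l) {i j : ℕ} (hij : i ≤ j) :
    (j : ℝ) ≤ l → poissonP l i ≤ poissonP l j := by
  induction j, hij using Nat.le_induction with
  | base => exact fun _ => le_rfl
  | succ j _ ih =>
    intro hj
    push_cast at hj
    refine (ih (by linarith)).trans ?_
    rw [poissonP_succ]
    exact le_mul_of_one_le_right (poissonP_pos hl j).le
      ((one_le_div (by positivity)).2 hj)

theorem poissonP_le {l : ℝ} (hl : 1 ≤ l) (i : ℕ) :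
    poissonP l i ≤ (2 * π * (⌊l⌋₊ : ℝ)) ^ (-(1 / 2) : ℝ) := by
  have hl0 : 0 < l := by linarith
  have hn : 1 ≤ ⌊l⌋₊ := (Nat.one_le_floor_iff l).2 hl
  have hn0 : (0 : ℝ) < ⌊l⌋₊ := by exact_mod_cast hn
  rcases le_total i ⌊l⌋₊ with hi | hi
  · exact (poissonP_le_of_le_floor hl0 hi (Nat.floor_le hl0.le)).trans
      (poissonP_le_stirling hl0.le hn)
  · refine (poissonP_le_stirling hl0.le (hn.trans hi)).trans
      (rpow_le_rpow_of_nonpos (by positivity) ?_ (by norm_num))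
    gcongr

/-- monotonicity in λ of ψ(α,·) and one-sided bounds. -/
theorem psiPoisson_monotonicity_and_bounds :
    (∀ α : ℝ, 0 < α → α < 1 →
      StrictMonoOn (fun l => psiPoisson α l) (Set.Ioi (0 : ℝ)) ∧
      ∀ l : ℝ, 1 ≤ l →
        psiPoisson α l ≥ (2 * Real.pi * (Nat.floor l : ℝ)) ^ ((1 - α) / 2)) ∧
    (∀ α : ℝ, 1 < α →
      StrictAntiOn (fun l => psiPoisson α l) (Set.Ioi (0 : ℝ)) ∧
      ∀ l : ℝ, 1 ≤ l →
        psiPoisson α l ≤ (2 * Real.pi * (Nat.floor l : ℝ)) ^ (-(α - 1) / 2)) := by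
  have hpow : ∀ α l : ℝ, ((2 * π * (⌊l⌋₊ : ℝ)) ^ (-(1 / 2) : ℝ)) ^ (α - 1)
      = (2 * π * (⌊l⌋₊ : ℝ)) ^ (-(α - 1) / 2) := fun α l => by
    rw [← rpow_mul (by positivity)]
    ring_nf
  have hfac : ∀ (α l : ℝ), 0 < l → ∀ i,
      poissonP l i ^ α = poissonP l i ^ (α - 1) * poissonP l i := fun α l hl i => by
    rw [rpow_sub_one (poissonP_pos hl i).ne', div_mul_cancel₀ _ (poissonP_pos hl i).ne']
  refine ⟨fun α h0 h1 => ⟨psiPoisson_strictMonoOn h0 h1, fun l hl => ?_⟩,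
    fun α h1 => ⟨psiPoisson_strictAntiOn h1, fun l hl => ?_⟩⟩
  · have hl0 : 0 < l := by linarith
    have hs := (hasSum_poissonP hl0.le).mul_left ((2 * π * (⌊l⌋₊ : ℝ)) ^ ((1 - α) / 2))
    rw [mul_one] at hs
    refine hasSum_le (fun i => ?_) hs (summable_poissonP_rpow h0 hl0).hasSum
    have hp := poissonP_pos hl0 i
    rw [hfac α l hl0, show (1 - α) / 2 = -(α - 1) / 2 by ring, ← hpow α l]
    exact mul_le_mul_of_nonneg_right
      (rpow_le_rpow_of_nonpos hp (poissonP_le hl i) (by linarith)) hp.le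
  · have hl0 : 0 < l := by linarith
    have hs := (hasSum_poissonP hl0.le).mul_left ((2 * π * (⌊l⌋₊ : ℝ)) ^ (-(α - 1) / 2))
    rw [mul_one] at hs
    refine hasSum_le (fun i => ?_) (summable_poissonP_rpow (by linarith) hl0).hasSum hs
    have hp := poissonP_pos hl0 i
    rw [hfac α l hl0, ← hpow α l]
    exact mul_le_mul_of_nonneg_right
      (rpow_le_rpow hp.le (poissonP_le hl i) (by linarith)) hp.le
end

section
/- For every α > 0, the limit as λ → ∞ of √α · (2πλ)^{(α-1)/2} · ψ(α,λ) equals 1; that is, ψ(α,λ) ~ α^{-1/2}·(2πλ)^{(1-α)/2} as λ → ∞. -/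
open Real Filter Topology

/-- Stirling's formula turns the Poisson probabilities into a product of factors tending to one and
an exponential. -/
theorem sqrt_mul_poissonP {l : ℝ} (hl : 0 < l) (i : ℕ) :
    √(2 * π * l) * poissonP l i =
      √((i + 1 : ℕ) / l) * (√π / Stirling.stirlingSeq (i + 1)) *
        exp ((i + 1 : ℕ) - l + (i + 1 : ℕ) * log (l / (i + 1 : ℕ))) := by
  have hn : (0 : ℝ) < ((i + 1 : ℕ) : ℝ) := by positivity
  have hexp : exp ((i + 1 : ℕ) - l + (i + 1 : ℕ) * log (l / (i + 1 : ℕ))) =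
      exp 1 ^ (i + 1) * exp (-l) * (l / (i + 1 : ℕ)) ^ (i + 1) := by
    rw [sub_eq_add_neg, exp_add, exp_add, exp_nat_mul, exp_log (by positivity), ← exp_nat_mul,
      mul_one]
  rw [hexp, Stirling.stirlingSeq, poissonP, Nat.factorial_succ, Nat.cast_mul]
  generalize ((i + 1 : ℕ) : ℝ) = n at *
  have h2 : √(2 * π * l) = √2 * √π * √l := by
    rw [sqrt_mul (by positivity), sqrt_mul (by positivity)]
  rw [h2, sqrt_div hn.le, sqrt_mul zero_le_two, div_pow, div_pow]
  have hl' : √l ^ 2 = l := sq_sqrt hl.le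
  have hn' : √n ^ 2 = n := sq_sqrt hn.le
  have : 0 < √l := sqrt_pos.2 hl
  have : 0 < √n := sqrt_pos.2 hn
  have hf : (0 : ℝ) < (Nat.factorial i : ℝ) := by positivity
  rw [pow_succ l]
  field_simp
  rw [hl', hn']

/-- A Chernoff bound for the exponent in Stirling's formula. -/
theorem poisson_exponent_le {l n : ℝ} (hl : 1 ≤ l) (hn : 0 < n) :
    n - l + n * log (l / n) ≤ 1 - |(n - l) / √l| := by
  have hl0 : 0 < l := by linarith
  have hs : 0 < √l := sqrt_pos.2 hl0
  have hs1 : 1 ≤ √l := one_le_sqrt.2 hl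
  have hss : √l * √l = l := mul_self_sqrt hl0.le
  have key (s : ℝ) (hs : |s| ≤ 1) : n - l + n * log (l / n) ≤ (n - l) * s + l * s ^ 2 := by
    have h1 : log (l / n) ≤ s + (l * exp (-s) / n - 1) := by
      have := log_le_sub_one_of_pos (show 0 < l / n * exp (-s) by positivity)
      rw [log_mul (by positivity) (by positivity), log_exp] at this
      have e : l / n * exp (-s) = l * exp (-s) / n := by ring
      rw [e] at this
      linarith
    have h2 := (abs_le.1 (abs_exp_sub_one_sub_id_le (x := -s) (by rwa [abs_neg]))).2
    have h3 : n * log (l / n) ≤ n * (s + (l * exp (-s) / n - 1)) := by gcongr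
    have h4 : n * (s + (l * exp (-s) / n - 1)) = n * s + l * exp (-s) - n := by
      field_simp
      ring
    nlinarith
  have hinv : |(√l)⁻¹| ≤ 1 := by
    rw [abs_of_pos (by positivity)]
    exact inv_le_one_of_one_le₀ hs1
  have hsq : l * (√l)⁻¹ ^ 2 = 1 := by
    rw [inv_pow, sq, hss, mul_inv_cancel₀ hl0.ne']
  have h1 := key (√l)⁻¹ hinv
  have h2 := key (-(√l)⁻¹) (by rwa [abs_neg])
  rw [neg_sq] at h2
  rw [hsq] at h1 h2
  rw [div_eq_mul_inv (n - l)]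
  rcases abs_cases ((n - l) * (√l)⁻¹) with h | h <;> linarith

theorem sqrt_mul_poissonP_le {l : ℝ} (hl : 1 ≤ l) (i : ℕ) :
    √(2 * π * l) * poissonP l i ≤ exp (1 - |((i + 1 : ℕ) - l) / √l| / 2) := by
  have hl0 : 0 < l := by linarith
  have hs : 0 < √l := sqrt_pos.2 hl0
  have hs1 : 1 ≤ √l := one_le_sqrt.2 hl
  have hss : √l * √l = l := mul_self_sqrt hl0.le
  have hn : (0 : ℝ) < ((i + 1 : ℕ) : ℝ) := by positivity
  rw [sqrt_mul_poissonP hl0]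
  have hE := poisson_exponent_le hl hn
  have hS : √π / Stirling.stirlingSeq (i + 1) ≤ 1 :=
    div_le_one_of_le₀ (Stirling.sqrt_pi_le_stirlingSeq i.succ_ne_zero)
      (Stirling.stirlingSeq'_pos i).le
  generalize ((i + 1 : ℕ) : ℝ) = n at *
  have hy : (n - l) / l ≤ |(n - l) / √l| := by
    have e : (n - l) / l = (n - l) / √l / √l := by rw [div_div, hss]
    rw [e]
    refine (le_abs_self _).trans ?_
    rw [abs_div _ √l, abs_of_pos hs]
    exact div_le_self (abs_nonneg _) hs1
  have hr : √(n / l) ≤ exp (|(n - l) / √l| / 2) := by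
    rw [sqrt_le_left (exp_pos _).le, ← exp_nat_mul]
    have e : n / l = (n - l) / l + 1 := by field_simp; ring
    rw [e]
    refine (add_one_le_exp _).trans (exp_le_exp.2 ?_)
    push_cast
    linarith
  calc √(n / l) * (√π / Stirling.stirlingSeq (i + 1)) * exp (n - l + n * log (l / n))
      ≤ exp (|(n - l) / √l| / 2) * 1 * exp (1 - |(n - l) / √l|) := by
        have := (Stirling.stirlingSeq'_pos i).le
        gcongr
    _ = exp (1 - |(n - l) / √l| / 2) := by
        rw [mul_one, ← exp_add]
        ring_nf

theorem abs_floor_add_one_sub_le {t : ℝ} (ht : 0 ≤ t) : |((⌊t⌋₊ + 1 : ℕ) : ℝ) - t| ≤ 1 := by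
  have h1 := Nat.floor_le ht
  have h2 := Nat.lt_floor_add_one t
  push_cast
  rw [abs_le]
  constructor <;> linarith

theorem abs_floor_rescale_sub_le {l x : ℝ} (hl : 0 < l) (ht : 0 ≤ l + √l * x) :
    |((⌊l + √l * x⌋₊ + 1 : ℕ) - l) / √l - x| ≤ 1 / √l := by
  have hs : 0 < √l := sqrt_pos.2 hl
  have e : (((⌊l + √l * x⌋₊ + 1 : ℕ) : ℝ) - l) / √l - x =
      (((⌊l + √l * x⌋₊ + 1 : ℕ) : ℝ) - (l + √l * x)) / √l := by
    field_simp
    ring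
  rw [e, abs_div, abs_of_pos hs]
  gcongr
  exact abs_floor_add_one_sub_le ht

theorem sqrt_mul_poissonP_floor_le {l x : ℝ} (hl : 1 ≤ l) (ht : 0 ≤ l + √l * x) :
    √(2 * π * l) * poissonP l ⌊l + √l * x⌋₊ ≤ exp (3 / 2 - |x| / 2) := by
  have hl0 : 0 < l := by linarith
  refine (sqrt_mul_poissonP_le hl _).trans (exp_le_exp.2 ?_)
  have h1 := abs_floor_rescale_sub_le hl0 ht
  have h2 : 1 / √l ≤ 1 := div_le_one_of_le₀ (one_le_sqrt.2 hl) (by positivity)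
  rw [abs_sub_comm] at h1
  have h3 := abs_sub_abs_le_abs_sub x (((⌊l + √l * x⌋₊ + 1 : ℕ) - l) / √l)
  linarith

theorem tendsto_poisson_exponent {n : ℝ → ℝ} {x : ℝ}
    (hn : Tendsto (fun l => (n l - l) / √l) atTop (𝓝 x)) :
    Tendsto (fun l => n l / l) atTop (𝓝 1) ∧
      Tendsto (fun l => n l - l + n l * log (l / n l)) atTop (𝓝 (-(x ^ 2) / 2)) := by
  have hsqrt : Tendsto (fun l : ℝ => (√l)⁻¹) atTop (𝓝 0) :=
    tendsto_inv_atTop_zero.comp tendsto_sqrt_atTop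
  have h1 : Tendsto (fun l => n l / l) atTop (𝓝 1) := by
    have := (hn.mul hsqrt).add_const 1
    rw [mul_zero, zero_add] at this
    refine this.congr' ?_
    filter_upwards [eventually_gt_atTop 0] with l hl
    have hss : √l * √l = l := mul_self_sqrt hl.le
    rw [← div_eq_mul_inv, div_div, hss]
    field_simp
    ring
  refine ⟨h1, ?_⟩
  have hpos : ∀ᶠ l in atTop, 0 < n l := by
    filter_upwards [h1.eventually_const_lt one_pos, eventually_gt_atTop 0] with l h hl
    exact (div_pos_iff_of_pos_right hl).1 h
  have h1' : Tendsto (fun l => l / n l) atTop (𝓝 1) := by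
    simpa using h1.inv₀ one_ne_zero
  have hu : Tendsto (fun l => 1 - l / n l) atTop (𝓝 0) := by
    simpa using h1'.const_sub 1
  have hu2 : Tendsto (fun l => n l * (1 - l / n l) ^ 2) atTop (𝓝 (x ^ 2)) := by
    have := (hn.pow 2).mul h1'
    rw [mul_one] at this
    refine this.congr' ?_
    filter_upwards [hpos, eventually_gt_atTop 0] with l h hl
    rw [div_pow, sq_sqrt hl.le]
    field_simp
  have hbound : Tendsto (fun l => n l * (1 - l / n l) ^ 2 *
      (|1 - l / n l| / (1 - |1 - l / n l|))) atTop (𝓝 0) := by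
    have h0 : Tendsto (fun l => |1 - l / n l|) atTop (𝓝 0) := by simpa using hu.abs
    simpa using hu2.mul (h0.div (h0.const_sub 1) (by norm_num))
  have hrem : Tendsto (fun l => n l - l + n l * log (l / n l) + n l * (1 - l / n l) ^ 2 / 2)
      atTop (𝓝 0) := by
    refine squeeze_zero_norm' ?_ hbound
    filter_upwards [hpos, hu.abs.eventually_lt_const (show |(0 : ℝ)| < 1 by simp)] with l h hlt
    have key := abs_log_sub_add_sum_range_le hlt 2
    have e : n l - l + n l * log (l / n l) + n l * (1 - l / n l) ^ 2 / 2 =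
        n l * ((∑ i ∈ Finset.range 2, (1 - l / n l) ^ (i + 1) / (i + 1)) +
          log (1 - (1 - l / n l))) := by
      rw [sub_sub_cancel, Finset.sum_range_succ, Finset.sum_range_one]
      generalize log (l / n l) = L
      push_cast
      field_simp
      ring
    rw [norm_eq_abs, e, abs_mul, abs_of_pos h, ← sq_abs (1 - l / n l)]
    calc _ ≤ n l * (|1 - l / n l| ^ (2 + 1) / (1 - |1 - l / n l|)) := by gcongr
      _ = _ := by ring
  have := hrem.sub (hu2.div_const 2)
  rw [zero_sub, ← neg_div] at this
  exact this.congr fun l => by ring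

theorem eventually_rescale_nonneg (x : ℝ) : ∀ᶠ l in atTop, 0 ≤ l + √l * x := by
  filter_upwards [tendsto_sqrt_atTop.eventually_ge_atTop |x|, eventually_ge_atTop 0] with l h hl
  have hss : √l * √l = l := mul_self_sqrt hl
  have := neg_abs_le x
  nlinarith [sqrt_nonneg l]

/-- The local limit theorem for the Poisson distribution. -/
theorem tendsto_sqrt_mul_poissonP_floor (x : ℝ) :
    Tendsto (fun l => √(2 * π * l) * poissonP l ⌊l + √l * x⌋₊) atTop
      (𝓝 (exp (-(x ^ 2) / 2))) := by
  have hn : Tendsto (fun l : ℝ => (((⌊l + √l * x⌋₊ + 1 : ℕ) : ℝ) - l) / √l) atTop (𝓝 x) := by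
    rw [tendsto_iff_norm_sub_tendsto_zero]
    have hsqrt : Tendsto (fun l : ℝ => 1 / √l) atTop (𝓝 0) := by
      simpa [Function.comp_def] using tendsto_inv_atTop_zero.comp tendsto_sqrt_atTop
    refine squeeze_zero' (.of_forall fun _ => norm_nonneg _) ?_ hsqrt
    filter_upwards [eventually_rescale_nonneg x, eventually_gt_atTop 0] with l h hl
    exact abs_floor_rescale_sub_le hl h
  obtain ⟨h1, h2⟩ := tendsto_poisson_exponent hn
  have hN : Tendsto (fun l : ℝ => ⌊l + √l * x⌋₊ + 1) atTop atTop := by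
    rw [← tendsto_natCast_atTop_iff (R := ℝ)]
    refine (h1.pos_mul_atTop one_pos tendsto_id).congr' ?_
    filter_upwards [eventually_gt_atTop 0] with l hl
    simp only [id]
    field_simp
  have hS : Tendsto (fun l : ℝ => √π / Stirling.stirlingSeq (⌊l + √l * x⌋₊ + 1)) atTop (𝓝 1) := by
    have hpi : √π ≠ 0 := (sqrt_pos.2 pi_pos).ne'
    have := (tendsto_const_nhds (x := √π)).div (Stirling.tendsto_stirlingSeq_sqrt_pi.comp hN) hpi
    rwa [div_self hpi] at this
  have := (h1.sqrt.mul hS).mul h2.rexp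
  rw [sqrt_one, one_mul, one_mul] at this
  refine this.congr' ?_
  filter_upwards [eventually_gt_atTop 0] with l hl
  rw [sqrt_mul_poissonP hl]

theorem poissonP_nonneg {l : ℝ} (hl : 0 ≤ l) (i : ℕ) : 0 ≤ poissonP l i := by
  unfold poissonP
  positivity

theorem integrable_exp_sub_mul_abs (a : ℝ) {b : ℝ} (hb : 0 < b) :
    MeasureTheory.Integrable fun x : ℝ => exp (a - b * |x|) := by
  refine MeasureTheory.Integrable.of_integral_ne_zero ?_
  rw [integral_comp_abs (f := fun x => exp (a - b * x))]
  have : (fun x => exp (a - b * x)) = fun x => exp a * exp (-b * x) := by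
    funext x
    rw [← exp_add]
    ring_nf
  rw [this, MeasureTheory.integral_const_mul, integral_exp_mul_Ioi (by linarith)]
  simp [hb.ne']

open MeasureTheory in
/-- A series is the integral of the associated step function on `[0, ∞)`. -/
theorem tsum_eq_integral_floor {f : ℕ → ℝ}
    (hf : Integrable ((Set.Ici (0 : ℝ)).indicator fun t => f ⌊t⌋₊)) :
    ∑' i, f i = ∫ t, (Set.Ici (0 : ℝ)).indicator (fun t => f ⌊t⌋₊) t := by
  have hU : (⋃ i : ℕ, Set.Ico (i : ℝ) (i + 1)) = Set.Ici 0 := by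
    ext t
    simp only [Set.mem_iUnion, Set.mem_Ico, Set.mem_Ici]
    exact ⟨fun ⟨i, h, _⟩ => (Nat.cast_nonneg i).trans h,
      fun h => ⟨⌊t⌋₊, Nat.floor_le h, Nat.lt_floor_add_one t⟩⟩
  have hfloor {i : ℕ} {t : ℝ} (ht : t ∈ Set.Ico (i : ℝ) (i + 1)) : ⌊t⌋₊ = i :=
    (Nat.floor_eq_iff ((Nat.cast_nonneg i).trans ht.1)).2 ht
  have hd : Pairwise (Function.onFun Disjoint fun i : ℕ => Set.Ico (i : ℝ) (i + 1)) :=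
    fun i j hij => Set.disjoint_left.2 fun t hi hj => hij ((hfloor hi).symm.trans (hfloor hj))
  rw [integrable_indicator_iff measurableSet_Ici, ← hU] at hf
  rw [integral_indicator measurableSet_Ici, ← hU,
    integral_iUnion (fun _ => measurableSet_Ico) hd hf]
  refine tsum_congr fun i => ?_
  rw [setIntegral_congr_fun measurableSet_Ico (g := fun _ => f i)
    fun t ht => congrArg f (hfloor ht)]
  simp

/-- The step function with values `p_i(l) ^ α`, centred at `l` and rescaled by `√l`, and normalised
so that it converges as `l` tends to infinity. -/
noncomputable def rescaledPoisson (α l x : ℝ) : ℝ :=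
  (Set.Ici (0 : ℝ)).indicator (fun t => (√(2 * π * l) * poissonP l ⌊t⌋₊) ^ α) (l + √l * x)

theorem measurable_rescaledPoisson (α l : ℝ) : Measurable (rescaledPoisson α l) := by
  have h : Measurable fun t : ℝ => (√(2 * π * l) * poissonP l ⌊t⌋₊) ^ α :=
    (measurable_of_countable fun i : ℕ => (√(2 * π * l) * poissonP l i) ^ α).comp
      Nat.measurable_floor
  exact (h.indicator measurableSet_Ici).comp (by fun_prop)

theorem norm_rescaledPoisson_le {α l : ℝ} (hα : 0 < α) (hl : 1 ≤ l) (x : ℝ) :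
    ‖rescaledPoisson α l x‖ ≤ exp (α * (3 / 2) - α / 2 * |x|) := by
  unfold rescaledPoisson
  by_cases ht : 0 ≤ l + √l * x
  · have h0 : 0 ≤ √(2 * π * l) * poissonP l ⌊l + √l * x⌋₊ :=
      mul_nonneg (sqrt_nonneg _) (poissonP_nonneg (by linarith) _)
    rw [Set.indicator_of_mem (Set.mem_Ici.2 ht), norm_of_nonneg (rpow_nonneg h0 _)]
    refine (rpow_le_rpow h0 (sqrt_mul_poissonP_floor_le hl ht) hα.le).trans_eq ?_
    rw [← exp_mul]
    ring_nf
  · rw [Set.indicator_of_notMem (by simpa using ht), norm_zero]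
    exact (exp_pos _).le

theorem integrable_rescaledPoisson {α l : ℝ} (hα : 0 < α) (hl : 1 ≤ l) :
    MeasureTheory.Integrable (rescaledPoisson α l) :=
  (integrable_exp_sub_mul_abs _ (half_pos hα)).mono'
    (measurable_rescaledPoisson α l).aestronglyMeasurable
    (.of_forall (norm_rescaledPoisson_le hα hl))

theorem tendsto_rescaledPoisson (α x : ℝ) :
    Tendsto (fun l => rescaledPoisson α l x) atTop (𝓝 (exp (-(α / 2) * x ^ 2))) := by
  have := (tendsto_sqrt_mul_poissonP_floor x).rpow_const (p := α) (Or.inl (exp_pos _).ne')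
  rw [← exp_mul, show -(x ^ 2) / 2 * α = -(α / 2) * x ^ 2 by ring] at this
  refine this.congr' ?_
  filter_upwards [eventually_rescale_nonneg x] with l h
  rw [rescaledPoisson, Set.indicator_of_mem (Set.mem_Ici.2 h)]

theorem tendsto_integral_rescaledPoisson {α : ℝ} (hα : 0 < α) :
    Tendsto (fun l => ∫ x, rescaledPoisson α l x) atTop (𝓝 √(π / (α / 2))) := by
  rw [← integral_gaussian]
  refine MeasureTheory.tendsto_integral_filter_of_dominated_convergence
    (fun x => exp (α * (3 / 2) - α / 2 * |x|))
    (.of_forall fun l => (measurable_rescaledPoisson α l).aestronglyMeasurable) ?_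
    (integrable_exp_sub_mul_abs _ (half_pos hα)) (.of_forall (tendsto_rescaledPoisson α))
  filter_upwards [eventually_ge_atTop 1] with l hl
  exact .of_forall (norm_rescaledPoisson_le hα hl)

theorem psiPoisson_eq_integral {α l : ℝ} (hα : 0 < α) (hl : 1 ≤ l) :
    √(2 * π * l) ^ α * psiPoisson α l = √l * ∫ x, rescaledPoisson α l x := by
  have hl0 : 0 < l := by linarith
  have hs : 0 < √l := sqrt_pos.2 hl0
  let G : ℝ → ℝ :=
    (Set.Ici (0 : ℝ)).indicator fun t => (√(2 * π * l) * poissonP l ⌊t⌋₊) ^ α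
  have hG : MeasureTheory.Integrable G := by
    have h := integrable_rescaledPoisson hα hl
    have h' := (MeasureTheory.integrable_comp_mul_left_iff (fun y => G (l + y)) hs.ne').1 h
    simpa using h'.comp_add_left (-l)
  have hsum := tsum_eq_integral_floor (f := fun i => (√(2 * π * l) * poissonP l i) ^ α) hG
  have hscale : ∫ x, rescaledPoisson α l x = (√l)⁻¹ * ∫ t, G t := by
    have h := MeasureTheory.Measure.integral_comp_mul_left (fun y => G (l + y)) √l
    rw [MeasureTheory.integral_add_left_eq_self G l, abs_of_pos (by positivity)] at h
    exact h
  rw [hscale, mul_inv_cancel_left₀ hs.ne']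
  refine Eq.trans ?_ hsum
  rw [psiPoisson, ← tsum_mul_left]
  exact tsum_congr fun i => (mul_rpow (sqrt_nonneg _) (poissonP_nonneg hl0.le i)).symm

/-- ψ(α,λ) ~ α^{-1/2}·(2πλ)^{(1-α)/2} as λ → ∞. -/
theorem psiPoisson_asymptotic (α : ℝ) (hα : 0 < α) :
    Tendsto (fun l : ℝ => Real.sqrt α * (2 * Real.pi * l) ^ ((α - 1) / 2) * psiPoisson α l)
      atTop (𝓝 1) := by
  have h := (tendsto_integral_rescaledPoisson hα).const_mul (√α / √(2 * π))
  have e : √α / √(2 * π) * √(π / (α / 2)) = 1 := by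
    rw [← sqrt_div hα.le, ← sqrt_mul (by positivity), ← sqrt_one]
    congr 1
    field_simp
  rw [e] at h
  refine h.congr' ?_
  filter_upwards [eventually_ge_atTop 1] with l hl
  have hl0 : 0 < l := by linarith
  have hs : 0 < √l := sqrt_pos.2 hl0
  have hpow : (2 * π * l) ^ ((α - 1) / 2) = √(2 * π * l) ^ α / (√(2 * π) * √l) := by
    rw [← sqrt_mul (by positivity), sqrt_eq_rpow, ← rpow_mul (by positivity),
      ← rpow_sub (by positivity)]
    congr 1
    ring
  have hψ := psiPoisson_eq_integral hα hl
  rw [hpow]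
  have : 0 < √(2 * π) := sqrt_pos.2 (by positivity)
  calc √α / √(2 * π) * ∫ x, rescaledPoisson α l x
      = √α / (√(2 * π) * √l) * (√l * ∫ x, rescaledPoisson α l x) := by field_simp
    _ = √α / (√(2 * π) * √l) * (√(2 * π * l) ^ α * psiPoisson α l) := by rw [hψ]
    _ = _ := by ring
end

section
/- For every α > 0 with α ≠ 1 and every β > 1, the Sharma–Mittal entropy of the Poisson distribution satisfies (1/(β-1))·(1 - (2π·⌊λ⌋)^{(1-β)/2}) ≤ H_SM(α,β,λ) < 1/(β-1) for all λ ≥ 1, and consequently lim_{λ→∞} H_SM(α,β,λ) = 1/(β-1). -/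
open Real Filter Topology

theorem hasSum_poissonP_s11 (l : ℝ) : HasSum (fun i => poissonP l i) 1 := by
  have h := (NormedSpace.expSeries_div_hasSum_exp l).mul_left (Real.exp (-l))
  rw [← Real.exp_eq_exp_ℝ, ← Real.exp_add, neg_add_cancel, Real.exp_zero] at h
  simpa only [poissonP, mul_div_assoc] using h

theorem psiPoisson_pos {α l : ℝ} (hα : 0 < α) (hl : 0 < l) : 0 < psiPoisson α l :=
  (summable_poissonP_rpow hα hl).tsum_pos (fun i => rpow_nonneg (poissonP_pos hl i).le α) 0
    (rpow_pos_of_pos (poissonP_pos hl 0) α)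

/-- A Poisson probability is at most the Stirling bound for its index. -/
theorem poissonP_le_inv_sqrt {l : ℝ} (hl : 0 < l) {i : ℕ} (hi : i ≠ 0) :
    poissonP l i ≤ (√(2 * π * i))⁻¹ := by
  have hi' : (0 : ℝ) < i := by positivity
  have hpow : l ^ i ≤ (i / Real.exp 1) ^ i * Real.exp l := by
    have h : l / i ≤ Real.exp (l / i - 1) := by linarith [Real.add_one_le_exp (l / i - 1)]
    have h' : l ≤ i / Real.exp 1 * Real.exp (l / i) := by
      rw [Real.exp_sub, div_le_iff₀ hi'] at h
      exact h.trans_eq (by ring)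
    calc l ^ i ≤ (i / Real.exp 1 * Real.exp (l / i)) ^ i := by gcongr
      _ = (i / Real.exp 1) ^ i * Real.exp l := by
        rw [mul_pow, ← Real.exp_nat_mul, mul_div_cancel₀ _ hi'.ne']
  have hst := Stirling.le_factorial_stirling i
  have hs : 0 < √(2 * π * i) := by positivity
  unfold poissonP
  rw [div_le_iff₀ (by positivity), inv_mul_eq_div, le_div_iff₀ hs]
  calc Real.exp (-l) * l ^ i * √(2 * π * i)
      ≤ Real.exp (-l) * ((i / Real.exp 1) ^ i * Real.exp l) * √(2 * π * i) := by gcongr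
    _ = √(2 * π * i) * (i / Real.exp 1) ^ i * (Real.exp (-l) * Real.exp l) := by ring
    _ = √(2 * π * i) * (i / Real.exp 1) ^ i := by
      rw [← Real.exp_add, neg_add_cancel, Real.exp_zero, mul_one]
    _ ≤ _ := hst

theorem poissonP_le_of_le {l : ℝ} (hl : 0 < l) {i n : ℕ} (hin : i ≤ n) (hn : (n : ℝ) ≤ l) :
    poissonP l i ≤ poissonP l n := by
  induction n, hin using Nat.le_induction with
  | base => exact le_rfl
  | succ n _ ih =>
    push_cast at hn
    refine (ih (by linarith)).trans ?_
    rw [poissonP_succ]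
    exact le_mul_of_one_le_right (poissonP_pos hl n).le ((one_le_div (by positivity)).2 hn)

theorem poissonP_le_inv_sqrt_floor {l : ℝ} (hl : 1 ≤ l) (i : ℕ) :
    poissonP l i ≤ (√(2 * π * ⌊l⌋₊))⁻¹ := by
  have hl0 : 0 < l := by linarith
  have hn : 0 < ⌊l⌋₊ := Nat.floor_pos.2 hl
  rcases le_total i ⌊l⌋₊ with h | h
  · exact (poissonP_le_of_le hl0 h (Nat.floor_le hl0.le)).trans
      (poissonP_le_inv_sqrt hl0 hn.ne')
  · refine (poissonP_le_inv_sqrt hl0 (hn.trans_le h).ne').trans ?_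
    gcongr

theorem psiPoisson_rpow_le {α β l M : ℝ} (hα : 0 < α) (hα1 : α ≠ 1) (hβ : 1 < β)
    (hl : 0 < l) (hM : ∀ i, poissonP l i ≤ M) :
    psiPoisson α l ^ ((1 - β) / (1 - α)) ≤ M ^ (β - 1) := by
  have hM0 : 0 < M := (poissonP_pos hl 0).trans_le (hM 0)
  have hsum := (hasSum_poissonP_s11 l).mul_left (M ^ (α - 1))
  rw [mul_one] at hsum
  have hψ : HasSum (fun i => poissonP l i ^ α) (psiPoisson α l) :=
    (summable_poissonP_rpow hα hl).hasSum
  have hsplit (i : ℕ) : poissonP l i ^ α = poissonP l i ^ (α - 1) * poissonP l i := by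
    rw [← rpow_add_one (poissonP_pos hl i).ne', sub_add_cancel]
  have hexp : (M ^ (α - 1)) ^ ((1 - β) / (1 - α)) = M ^ (β - 1) := by
    have h : 1 - α ≠ 0 := sub_ne_zero.2 hα1.symm
    rw [← rpow_mul hM0.le]
    congr 1
    field_simp
    ring
  rw [← hexp]
  rcases lt_or_gt_of_ne hα1 with h | h
  · refine rpow_le_rpow_of_nonpos (by positivity) (hasSum_le (fun i => ?_) hsum hψ)
      (div_nonpos_of_nonpos_of_nonneg (by linarith) (by linarith))
    rw [hsplit]
    exact mul_le_mul_of_nonneg_right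
      (rpow_le_rpow_of_nonpos (poissonP_pos hl i) (hM i) (by linarith)) (poissonP_pos hl i).le
  · refine rpow_le_rpow (psiPoisson_pos hα hl).le (hasSum_le (fun i => ?_) hψ hsum)
      (div_nonneg_of_nonpos (by linarith) (by linarith))
    rw [hsplit]
    exact mul_le_mul_of_nonneg_right
      (rpow_le_rpow (poissonP_pos hl i).le (hM i) (by linarith)) (poissonP_pos hl i).le

/-- bounds and limit for the Sharma–Mittal entropy of the Poisson
distribution when β > 1. -/
theorem sharmaMittal_poisson_bounds_limit (α β : ℝ) (hα : 0 < α) (hα1 : α ≠ 1)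
    (hβ : 1 < β) :
    (∀ l : ℝ, 1 ≤ l →
      (1 / (β - 1)) * (1 - (2 * Real.pi * (Nat.floor l : ℝ)) ^ ((1 - β) / 2)) ≤
        (1 - β)⁻¹ * ((psiPoisson α l) ^ ((1 - β) / (1 - α)) - 1) ∧
      (1 - β)⁻¹ * ((psiPoisson α l) ^ ((1 - β) / (1 - α)) - 1) < 1 / (β - 1)) ∧
    Tendsto (fun l : ℝ => (1 - β)⁻¹ * ((psiPoisson α l) ^ ((1 - β) / (1 - α)) - 1))
      atTop (𝓝 (1 / (β - 1))) := by
  have hβ0 : 0 < β - 1 := by linarith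
  have hc : 0 < 1 / (β - 1) := by positivity
  have hrew (x : ℝ) : (1 - β)⁻¹ * (x - 1) = 1 / (β - 1) * (1 - x) := by
    rw [← neg_sub β 1, inv_neg]
    ring
  have hbounds (l : ℝ) (hl : 1 ≤ l) :
      (1 / (β - 1)) * (1 - (2 * Real.pi * (Nat.floor l : ℝ)) ^ ((1 - β) / 2)) ≤
        (1 - β)⁻¹ * ((psiPoisson α l) ^ ((1 - β) / (1 - α)) - 1) ∧
      (1 - β)⁻¹ * ((psiPoisson α l) ^ ((1 - β) / (1 - α)) - 1) < 1 / (β - 1) := by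
    have hl0 : 0 < l := by linarith
    rw [hrew]
    constructor
    · have h := psiPoisson_rpow_le hα hα1 hβ hl0 (poissonP_le_inv_sqrt_floor hl)
      have hx : 0 ≤ 2 * π * (⌊l⌋₊ : ℝ) := by positivity
      have he : ((√(2 * π * ⌊l⌋₊))⁻¹) ^ (β - 1) = (2 * π * (⌊l⌋₊ : ℝ)) ^ ((1 - β) / 2) := by
        rw [sqrt_eq_rpow, ← rpow_neg hx, ← rpow_mul hx]
        congr 1
        ring
      rw [he] at h
      gcongr
    · have := rpow_pos_of_pos (psiPoisson_pos hα hl0) ((1 - β) / (1 - α))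
      exact mul_lt_of_lt_one_right hc (by linarith)
  refine ⟨hbounds, ?_⟩
  have hlim : Tendsto (fun l : ℝ =>
      (1 / (β - 1)) * (1 - (2 * Real.pi * (Nat.floor l : ℝ)) ^ ((1 - β) / 2)))
      atTop (𝓝 (1 / (β - 1))) := by
    have hx : Tendsto (fun l : ℝ => 2 * π * (⌊l⌋₊ : ℝ)) atTop atTop :=
      (tendsto_natCast_atTop_atTop.comp tendsto_nat_floor_atTop).const_mul_atTop (by positivity)
    have h := (tendsto_rpow_neg_atTop (half_pos hβ0)).comp hx
    have h' := (h.const_sub 1).const_mul (1 / (β - 1))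
    rw [sub_zero, mul_one] at h'
    refine h'.congr fun l => ?_
    rw [Function.comp_apply, ← neg_div, neg_sub]
  refine tendsto_of_tendsto_of_tendsto_of_le_of_le' hlim tendsto_const_nhds ?_ ?_
  · filter_upwards [eventually_ge_atTop 1] with l hl using (hbounds l hl).1
  · filter_upwards [eventually_ge_atTop 1] with l hl using (hbounds l hl).2.le
end
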